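/- Let f and g be smooth (C^∞) real-valued functions on A × [0, ε), where A is an open domain in ℝ^m and ε > 0. Denote by f^(k), g^(k) the k-th partial derivatives in the last variable. Suppose there is k ≥ 0 such that for all x ∈ A we have f(x,0) = g(x,0) = … = f^(k)(x,0) = g^(k)(x,0) = 0 but g^(k+1)(x,0) ≠ 0, and g ≠ 0 on A × (0, ε). Then the function f/g, defined on A × (0, ε), admits a smooth extension to A × [0, ε). -/

import Mathlib

open Filter Topology

theorem param_hasFDeriv {E F : Type} [NormedAddCommGroup E] [NormedSpace ℝ E]
    [NormedAddCommGroup F] [NormedSpace ℝ F] [CompleteSpace F]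
    (S : Set E) (hS : Convex ℝ S) (hU : UniqueDiffOn ℝ S) (Φ : E × ℝ → F)
    (hΦ : ContDiffOn ℝ (⊤ : ℕ∞) Φ (S ×ˢ Set.Icc 0 1)) (p : E) (hp : p ∈ S) :
    HasFDerivWithinAt (fun q => ∫ s in (0:ℝ)..1, Φ (q, s))
      (∫ s in (0:ℝ)..1, (fderivWithin ℝ Φ (S ×ˢ Set.Icc 0 1) (p, s)).comp
        (ContinuousLinearMap.inl ℝ E ℝ)) S p := by
  have hUT : UniqueDiffOn ℝ (S ×ˢ Set.Icc (0:ℝ) 1) :=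
    hU.prod (uniqueDiffOn_Icc zero_lt_one)
  set T := S ×ˢ Set.Icc (0:ℝ) 1 with hT
  let D : E → ℝ → (E →L[ℝ] F) := fun q s =>
    (fderivWithin ℝ Φ T (q, s)).comp (ContinuousLinearMap.inl ℝ E ℝ)
  have hD : ContinuousOn (Function.uncurry D) T := by
    have h1 : ContinuousOn (fderivWithin ℝ Φ T) T :=
      hΦ.continuousOn_fderivWithin hUT (by simp)
    exact h1.clm_comp continuousOn_const
  have hDp : ∀ q ∈ S, ContinuousOn (D q) (Set.Icc 0 1) := fun q hq =>
    hD.comp (f := fun s => (q, s)) (by fun_prop) (fun s hs => ⟨hq, hs⟩)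
  have hΦp : ∀ q ∈ S, ContinuousOn (fun s => Φ (q, s)) (Set.Icc 0 1) := fun q hq =>
    hΦ.continuousOn.comp (f := fun s => (q, s)) (by fun_prop) (fun s hs => ⟨hq, hs⟩)
  have hder : ∀ q ∈ S, ∀ s ∈ Set.Icc (0:ℝ) 1,
      HasFDerivWithinAt (fun q => Φ (q, s)) (D q s) S q := by
    intro q hq s hs
    have h1 : HasFDerivWithinAt Φ (fderivWithin ℝ Φ T (q, s)) T (q, s) :=
      ((hΦ.differentiableOn (by simp)) (q, s) ⟨hq, hs⟩).hasFDerivWithinAt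
    have h2 : HasFDerivWithinAt (fun q : E => (q, s)) (ContinuousLinearMap.inl ℝ E ℝ) S q :=
      (hasFDerivAt_prodMk_left q s).hasFDerivWithinAt
    have hm : Set.MapsTo (fun q : E => (q, s)) S T := fun q' hq' => ⟨hq', hs⟩
    exact h1.comp q h2 hm
  rw [hasFDerivWithinAt_iff_isLittleO, Asymptotics.isLittleO_iff]
  intro c hc
  obtain ⟨v, hv, hv'⟩ := isCompact_Icc.mem_uniformity_of_prod hD hp (Metric.dist_mem_uniformity hc)
  obtain ⟨r, hr, hrv⟩ := Metric.mem_nhdsWithin_iff.1 hv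
  filter_upwards [self_mem_nhdsWithin, mem_nhdsWithin_of_mem_nhds (Metric.ball_mem_nhds p hr)]
    with q hq hqr
  have i1 : IntervalIntegrable (fun s => Φ (q, s)) MeasureTheory.volume 0 1 :=
    (hΦp q hq).intervalIntegrable_of_Icc zero_le_one
  have i2 : IntervalIntegrable (fun s => Φ (p, s)) MeasureTheory.volume 0 1 :=
    (hΦp p hp).intervalIntegrable_of_Icc zero_le_one
  have i3 : IntervalIntegrable (D p) MeasureTheory.volume 0 1 :=
    (hDp p hp).intervalIntegrable_of_Icc zero_le_one
  have i4 : IntervalIntegrable (fun s => D p s (q - p)) MeasureTheory.volume 0 1 :=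
    ((hDp p hp).clm_apply continuousOn_const).intervalIntegrable_of_Icc zero_le_one
  have e : (∫ s in (0:ℝ)..1, Φ (q, s)) - (∫ s in (0:ℝ)..1, Φ (p, s))
      - (∫ s in (0:ℝ)..1, D p s) (q - p)
      = ∫ s in (0:ℝ)..1, (Φ (q, s) - Φ (p, s) - D p s (q - p)) := by
    rw [intervalIntegral.integral_sub (i1.sub i2) i4, intervalIntegral.integral_sub i1 i2,
      ContinuousLinearMap.intervalIntegral_apply i3]
  change ‖(∫ s in (0:ℝ)..1, Φ (q, s)) - (∫ s in (0:ℝ)..1, Φ (p, s))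
      - (∫ s in (0:ℝ)..1, D p s) (q - p)‖ ≤ _
  rw [e]
  have := intervalIntegral.norm_integral_le_of_norm_le_const (a := (0:ℝ)) (b := 1)
    (f := fun s => (Φ (q, s) - Φ (p, s) - D p s (q - p))) (C := c * ‖q - p‖) ?_
  · simpa using this
  intro s hs
  rw [Set.uIoc_of_le zero_le_one] at hs
  have hs' : s ∈ Set.Icc (0:ℝ) 1 := ⟨hs.1.le, hs.2⟩
  refine Convex.norm_image_sub_le_of_norm_hasFDerivWithin_le' (𝕜 := ℝ) (f := fun q => Φ (q, s))
    (f' := fun q => D q s) (s := Metric.ball p r ∩ S) ?_ ?_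
    ((convex_ball p r).inter hS) ⟨Metric.mem_ball_self hr, hp⟩ ⟨hqr, hq⟩
  · exact fun y hy => (hder y hy.2 s hs').mono Set.inter_subset_right
  · intro y hy
    have := hv' y (hrv hy) s hs'
    rw [← dist_eq_norm]
    exact le_of_lt this

theorem param_contDiff_nat {E : Type} [NormedAddCommGroup E] [NormedSpace ℝ E]
    (S : Set E) (hS : Convex ℝ S) (hU : UniqueDiffOn ℝ S) (n : ℕ) :
    ∀ {F : Type} [NormedAddCommGroup F] [NormedSpace ℝ F] [CompleteSpace F] (Φ : E × ℝ → F)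
    (_ : ContDiffOn ℝ (⊤ : ℕ∞) Φ (S ×ˢ Set.Icc 0 1)),
    ContDiffOn ℝ n (fun q => ∫ s in (0:ℝ)..1, Φ (q, s)) S := by
  induction n with
  | zero =>
    intro F _ _ _ Φ hΦ
    exact contDiffOn_zero.2 fun p hp => (param_hasFDeriv S hS hU Φ hΦ p hp).continuousWithinAt
  | succ n ih =>
    intro F _ _ _ Φ hΦ
    push_cast
    rw [contDiffOn_succ_iff_hasFDerivWithinAt_of_uniqueDiffOn hU]
    refine ⟨by simp, _, ?_, fun p hp => param_hasFDeriv S hS hU Φ hΦ p hp⟩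
    refine ih (fun z => (fderivWithin ℝ Φ (S ×ˢ Set.Icc 0 1) z).comp
        (ContinuousLinearMap.inl ℝ E ℝ)) ?_
    exact (hΦ.fderivWithin (hU.prod (uniqueDiffOn_Icc zero_lt_one)) (by simp)).clm_comp
      contDiffOn_const

theorem hadamard {m : ℕ} (A : Set (Fin m → ℝ)) (hA : IsOpen A) (ε : ℝ) (hε : 0 < ε)
    (f : (Fin m → ℝ) × ℝ → ℝ) (hf : ContDiffOn ℝ (⊤ : ℕ∞) f (A ×ˢ Set.Ico 0 ε))
    (h0 : ∀ x ∈ A, f (x, 0) = 0) :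
    ∃ h : (Fin m → ℝ) × ℝ → ℝ, ContDiffOn ℝ (⊤ : ℕ∞) h (A ×ˢ Set.Ico 0 ε) ∧
      ∀ x ∈ A, ∀ t ∈ Set.Ico 0 ε, f (x, t) = t * h (x, t) := by
  have hUA : UniqueDiffOn ℝ (A ×ˢ Set.Ico 0 ε) := hA.uniqueDiffOn.prod (uniqueDiffOn_Ico 0 ε)
  have hmul : ∀ t ∈ Set.Ico 0 ε, ∀ s ∈ Set.Icc (0:ℝ) 1, s * t ∈ Set.Ico 0 ε := fun t ht s hs =>
    ⟨mul_nonneg hs.1 ht.1, lt_of_le_of_lt (mul_le_of_le_one_left ht.1 hs.2) ht.2⟩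
  set S := A ×ˢ Set.Ico 0 ε with hSdef
  let Ψ : (Fin m → ℝ) × ℝ → ℝ := fun z => fderivWithin ℝ f S z (0, 1)
  have hΨ : ContDiffOn ℝ (⊤ : ℕ∞) Ψ S :=
    (hf.fderivWithin hUA (by simp)).clm_apply contDiffOn_const
  refine ⟨fun p => ∫ s in (0:ℝ)..1, Ψ (p.1, s * p.2), ?_, ?_⟩
  · apply contDiffOn_of_locally_contDiffOn
    rintro ⟨x, t⟩ ⟨hx, ht⟩
    obtain ⟨r, hr, hrA⟩ := Metric.isOpen_iff.1 hA x hx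
    refine ⟨Metric.ball x r ×ˢ Set.univ, Metric.isOpen_ball.prod isOpen_univ,
      ⟨Metric.mem_ball_self hr, trivial⟩, ?_⟩
    have hsub : S ∩ Metric.ball x r ×ˢ Set.univ ⊆ Metric.ball x r ×ˢ Set.Ico 0 ε :=
      fun z hz => ⟨hz.2.1, hz.1.2⟩
    refine ContDiffOn.mono ?_ hsub
    rw [contDiffOn_infty]
    intro n
    refine param_contDiff_nat (Metric.ball x r ×ˢ Set.Ico 0 ε)
      ((convex_ball x r).prod (convex_Ico 0 ε))
      (Metric.isOpen_ball.uniqueDiffOn.prod (uniqueDiffOn_Ico 0 ε)) n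
      (fun z : ((Fin m → ℝ) × ℝ) × ℝ => Ψ (z.1.1, z.2 * z.1.2)) ?_
    refine hΨ.comp (f := fun z : ((Fin m → ℝ) × ℝ) × ℝ => (z.1.1, z.2 * z.1.2)) ?_ ?_
    · apply ContDiff.contDiffOn
      fun_prop
    · rintro ⟨⟨y, u⟩, s⟩ ⟨⟨hy, hu⟩, hs⟩
      exact ⟨hrA hy, hmul u hu s hs⟩
  · intro x hx t ht
    have hmaps : Set.MapsTo (fun s : ℝ => (x, s * t)) (Set.Icc 0 1) S :=
      fun s hs => ⟨hx, hmul t ht s hs⟩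
    have hd : ∀ s ∈ Set.Icc (0:ℝ) 1,
        HasDerivWithinAt (fun s => f (x, s * t)) (t * Ψ (x, s * t)) (Set.Icc 0 1) s := by
      intro s hs
      have h1 : HasFDerivWithinAt f (fderivWithin ℝ f S (x, s * t)) S (x, s * t) :=
        ((hf.differentiableOn (by simp)) _ (hmaps hs)).hasFDerivWithinAt
      have h2 : HasDerivWithinAt (fun s : ℝ => (x, s * t)) ((0 : Fin m → ℝ), t)
          (Set.Icc 0 1) s := by
        refine (hasDerivWithinAt_const s _ x).prodMk ?_
        simpa using (hasDerivWithinAt_id s (Set.Icc 0 1)).mul_const t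
      have h3 := h1.comp_hasDerivWithinAt s h2 hmaps
      have e1 : ((0 : Fin m → ℝ), t) = t • ((0 : Fin m → ℝ), (1:ℝ)) := by simp
      rw [e1, map_smul, smul_eq_mul] at h3
      exact h3
    have hc : ContinuousOn (fun s => t * Ψ (x, s * t)) (Set.Icc 0 1) :=
      continuousOn_const.mul (hΨ.continuousOn.comp (by fun_prop) hmaps)
    have := intervalIntegral.integral_eq_sub_of_hasDerivAt_of_le zero_le_one
      (fun s hs => (hd s hs).continuousWithinAt)
      (fun s hs => (hd s ⟨hs.1.le, hs.2.le⟩).hasDerivAt (Icc_mem_nhds hs.1 hs.2))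
      (hc.intervalIntegrable_of_Icc zero_le_one)
    rw [intervalIntegral.integral_const_mul] at this
    simp only [one_mul, zero_mul, h0 x hx, sub_zero] at this
    exact this.symm

theorem iter_pow_mul (ε : ℝ) (hε : 0 < ε) (n : ℕ) :
    ∀ (u : ℝ → ℝ), ContDiffOn ℝ (⊤ : ℕ∞) u (Set.Ico 0 ε) →
      iteratedDerivWithin n (fun t => t ^ n * u t) (Set.Ico 0 ε) 0 = n.factorial * u 0 := by
  have hU := uniqueDiffOn_Ico 0 ε
  have h0 : (0:ℝ) ∈ Set.Ico 0 ε := ⟨le_rfl, hε⟩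
  induction n with
  | zero => intro u hu; simp
  | succ n ih =>
    intro u hu
    have hu' : ContDiffOn ℝ (⊤ : ℕ∞) (derivWithin u (Set.Ico 0 ε)) (Set.Ico 0 ε) :=
      ((contDiffOn_infty_iff_derivWithin hU).1 hu).2
    rw [iteratedDerivWithin_succ']
    have : Set.EqOn (derivWithin (fun t => t ^ (n + 1) * u t) (Set.Ico 0 ε))
        (fun t => t ^ n * ((n + 1) * u t + t * derivWithin u (Set.Ico 0 ε) t))
        (Set.Ico 0 ε) := by
      intro t ht
      have h1 := (hu.differentiableOn (by simp) t ht).hasDerivWithinAt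
      have h2 := ((hasDerivAt_pow (n + 1) t).hasDerivWithinAt (s := Set.Ico 0 ε)).mul h1
      have h3 := h2.derivWithin (hU t ht)
      refine Eq.trans h3 ?_
      rw [Nat.add_sub_cancel]
      push_cast
      ring
    rw [iteratedDerivWithin_congr this h0, ih]
    · rw [Nat.factorial_succ]; push_cast; ring
    · exact (contDiffOn_const.mul hu).add (contDiffOn_id.mul hu')

theorem slice_smooth {m : ℕ} (A : Set (Fin m → ℝ)) (ε : ℝ)
    (f : (Fin m → ℝ) × ℝ → ℝ) (hf : ContDiffOn ℝ (⊤ : ℕ∞) f (A ×ˢ Set.Ico 0 ε))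
    (x : Fin m → ℝ) (hx : x ∈ A) :
    ContDiffOn ℝ (⊤ : ℕ∞) (fun t => f (x, t)) (Set.Ico 0 ε) :=
  hf.comp (f := fun t => (x, t)) (by fun_prop) (fun _ ht => ⟨hx, ht⟩)

theorem hadamard_iter {m : ℕ} (A : Set (Fin m → ℝ)) (hA : IsOpen A) (ε : ℝ) (hε : 0 < ε)
    (f : (Fin m → ℝ) × ℝ → ℝ) (hf : ContDiffOn ℝ (⊤ : ℕ∞) f (A ×ˢ Set.Ico 0 ε)) (n : ℕ)
    (hz : ∀ x ∈ A, ∀ j < n, iteratedDerivWithin j (fun t => f (x, t)) (Set.Ico 0 ε) 0 = 0) :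
    ∃ h : (Fin m → ℝ) × ℝ → ℝ, ContDiffOn ℝ (⊤ : ℕ∞) h (A ×ˢ Set.Ico 0 ε) ∧
      (∀ x ∈ A, ∀ t ∈ Set.Ico 0 ε, f (x, t) = t ^ n * h (x, t)) ∧
      ∀ x ∈ A, iteratedDerivWithin n (fun t => f (x, t)) (Set.Ico 0 ε) 0
        = n.factorial * h (x, 0) := by
  have key : ∀ n : ℕ, ∀ h : (Fin m → ℝ) × ℝ → ℝ,
      ContDiffOn ℝ (⊤ : ℕ∞) h (A ×ˢ Set.Ico 0 ε) →
      (∀ x ∈ A, ∀ t ∈ Set.Ico 0 ε, f (x, t) = t ^ n * h (x, t)) →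
      ∀ x ∈ A, iteratedDerivWithin n (fun t => f (x, t)) (Set.Ico 0 ε) 0
        = n.factorial * h (x, 0) := by
    intro n h hh he x hx
    rw [← iter_pow_mul ε hε n (fun t => h (x, t)) (slice_smooth A ε h hh x hx)]
    exact iteratedDerivWithin_congr (fun t ht => he x hx t ht) ⟨le_rfl, hε⟩
  induction n with
  | zero =>
    exact ⟨f, hf, by simp, by simp⟩
  | succ n ih =>
    obtain ⟨h, hh, he, hd⟩ := ih (fun x hx j hj => hz x hx j (by omega))
    obtain ⟨h', hh', he'⟩ := hadamard A hA ε hε h hh (fun x hx => by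
      have h1 := hd x hx
      rw [hz x hx n (by omega)] at h1
      have := n.factorial_ne_zero
      have : (n.factorial : ℝ) ≠ 0 := by exact_mod_cast this
      simpa [this] using h1.symm)
    have he2 : ∀ x ∈ A, ∀ t ∈ Set.Ico 0 ε, f (x, t) = t ^ (n + 1) * h' (x, t) := by
      intro x hx t ht
      rw [he x hx t ht, he' x hx t ht]; ring
    exact ⟨h', hh', he2, key (n + 1) h' hh' he2⟩

theorem stmt1 {m : ℕ} (A : Set (Fin m → ℝ)) (hA : IsOpen A) (ε : ℝ) (hε : 0 < ε)
    (f g : (Fin m → ℝ) × ℝ → ℝ)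
    (hf : ContDiffOn ℝ (⊤ : ℕ∞) f (A ×ˢ Set.Ico 0 ε)) (hg : ContDiffOn ℝ (⊤ : ℕ∞) g (A ×ˢ Set.Ico 0 ε))
    (k : ℕ)
    (hzero : ∀ x ∈ A, ∀ j ≤ k,
      iteratedDerivWithin j (fun t => f (x, t)) (Set.Ico 0 ε) 0 = 0 ∧
      iteratedDerivWithin j (fun t => g (x, t)) (Set.Ico 0 ε) 0 = 0)
    (hgk : ∀ x ∈ A, iteratedDerivWithin (k + 1) (fun t => g (x, t)) (Set.Ico 0 ε) 0 ≠ 0)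
    (hgne : ∀ x ∈ A, ∀ t ∈ Set.Ioo 0 ε, g (x, t) ≠ 0) :
    ∃ h : (Fin m → ℝ) × ℝ → ℝ, ContDiffOn ℝ (⊤ : ℕ∞) h (A ×ˢ Set.Ico 0 ε) ∧
      ∀ x ∈ A, ∀ t ∈ Set.Ioo 0 ε, h (x, t) = f (x, t) / g (x, t) := by
  obtain ⟨F, hF, hFe, -⟩ := hadamard_iter A hA ε hε f hf (k + 1)
    (fun x hx j hj => (hzero x hx j (by omega)).1)
  obtain ⟨G, hG, hGe, hGd⟩ := hadamard_iter A hA ε hε g hg (k + 1)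
    (fun x hx j hj => (hzero x hx j (by omega)).2)
  refine ⟨fun p => F p / G p, hF.div hG ?_, ?_⟩
  · rintro ⟨x, t⟩ ⟨hx, ht⟩ h0
    rcases eq_or_lt_of_le ht.1 with h | h
    · simp only at h
      subst h
      exact hgk x hx (by rw [hGd x hx, h0, mul_zero])
    · exact hgne x hx t ⟨h, ht.2⟩ (by rw [hGe x hx t ht, h0, mul_zero])
  · intro x hx t ht
    have ht' : t ∈ Set.Ico 0 ε := ⟨ht.1.le, ht.2⟩
    rw [hFe x hx t ht', hGe x hx t ht', mul_div_mul_left _ _ (pow_ne_zero _ ht.1.ne')]
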